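/- Let (G,I,O,λ) be an open graph with λ : Oᶜ → {{X},{Z},{X,Z}}, and let p : Oᶜ → 2^{Iᶜ} be a map such that for every u ∈ Oᶜ: Odd(p(u)) ∖ (O ∪ λ⁻¹({Z})) = {u} ∖ λ⁻¹({Z}) and p(u) ∖ (O ∪ λ⁻¹({X})) = {u} ∖ λ⁻¹({X}). Then (p, ∅), where ∅ denotes the empty strict partial order on Oᶜ (no two elements are comparable), is a Pauli flow of (G,I,O,λ). In particular all vertices can be measured in parallel. -/

import Mathlib

inductive Pauli : Type
  | X
  | Y
  | Z
  deriving DecidableEq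

open Finset
open scoped symmDiff

variable {V : Type*} [Fintype V] [DecidableEq V]

instance : Std.Commutative (α := Finset V) (· ∆ ·) := ⟨symmDiff_comm⟩
instance : Std.Associative (α := Finset V) (· ∆ ·) := ⟨symmDiff_assoc⟩

/-- Odd neighbourhood of `A`: the symmetric difference `Δ_{v ∈ A} N(v)` of the open
neighbourhoods of the elements of `A`. -/
def SimpleGraph.oddNbhd (G : SimpleGraph V) [DecidableRel G.Adj] (A : Finset V) : Finset V :=
  A.fold (· ∆ ·) ∅ fun v => G.neighborFinset v

/-- Closed odd neighbourhood of `A`: the symmetric difference `Δ_{v ∈ A} N[v]` of the closed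
neighbourhoods `N[v] = N(v) ∪ {v}` of the elements of `A`. -/
def SimpleGraph.coddNbhd (G : SimpleGraph V) [DecidableRel G.Adj] (A : Finset V) : Finset V :=
  A.fold (· ∆ ·) ∅ fun v => insert v (G.neighborFinset v)

/-- `(p, lt)` is a Pauli flow of the open graph `(G, I, O, lam)`: `lt` is a strict partial
order on `Oᶜ`, `p : Oᶜ → 2^{Iᶜ}`, and the conditions (cX), (cY), (cZ) hold for every
`u ∈ Oᶜ` (where `v ≥ u` means `¬ (v < u)`). -/
def IsPauliFlow (G : SimpleGraph V) [DecidableRel G.Adj] (I O : Finset V)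
    (lam : V → Finset Pauli) (p : V → Finset V) (lt : V → V → Prop) : Prop :=
  IsIrrefl V lt ∧ IsTrans V lt ∧
  (∀ u, u ∉ O → Disjoint (p u) I) ∧
  ∀ u, u ∉ O →
    ((Pauli.X ∈ lam u → u ∈ G.oddNbhd (p u) ∧
        ∀ v, v ∉ O → v ≠ u → ¬ lt v u → u ∉ G.oddNbhd (p v)) ∧
     (Pauli.Y ∈ lam u → u ∈ G.coddNbhd (p u) ∧
        ∀ v, v ∉ O → v ≠ u → ¬ lt v u → u ∉ G.coddNbhd (p v)) ∧
     (Pauli.Z ∈ lam u → u ∈ p u ∧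
        ∀ v, v ∉ O → v ≠ u → ¬ lt v u → u ∉ p v))

/-- If all measurements are real Pauli measurements (`λ_u ∈ {{X},{Z},{X,Z}}`) and
`p : Oᶜ → 2^{Iᶜ}` satisfies the super-normal-form equations
`Odd(p(u)) ∖ (O ∪ λ⁻¹({Z})) = {u} ∖ λ⁻¹({Z})` and `p(u) ∖ (O ∪ λ⁻¹({X})) = {u} ∖ λ⁻¹({X})`
for every `u ∈ Oᶜ`, then `(p, ∅)` — with the empty strict partial order, in which no two
elements are comparable — is a Pauli flow of `(G,I,O,λ)`. -/
theorem normal_form_isPauliFlow_empty_order (G : SimpleGraph V) [DecidableRel G.Adj]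
    (I O : Finset V) (lam : V → Finset Pauli)
    (hreal : ∀ u, u ∉ O →
      lam u = {Pauli.X} ∨ lam u = {Pauli.Z} ∨ lam u = {Pauli.X, Pauli.Z})
    (p : V → Finset V) (hp : ∀ u, u ∉ O → Disjoint (p u) I)
    (hnf : ∀ u, u ∉ O →
      G.oddNbhd (p u) \ (O ∪ univ.filter fun w => w ∉ O ∧ lam w = {Pauli.Z}) =
        {u} \ univ.filter (fun w => w ∉ O ∧ lam w = {Pauli.Z}) ∧
      p u \ (O ∪ univ.filter fun w => w ∉ O ∧ lam w = {Pauli.X}) =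
        {u} \ univ.filter (fun w => w ∉ O ∧ lam w = {Pauli.X})) :
    IsPauliFlow G I O lam p (fun _ _ => False) := by
  have lam_ne : ∀ {u : V} {a b : Pauli}, a ∈ lam u → a ≠ b → lam u ≠ {b} := by
    intro u a b ha hab h
    exact hab (mem_singleton.1 (h ▸ ha))
  have mem_iff_eq : ∀ {A : Finset V} {u v : V} {a : Pauli}, u ∉ O → lam u ≠ {a} →
      A \ (O ∪ univ.filter fun w => w ∉ O ∧ lam w = {a}) =
        {v} \ univ.filter (fun w => w ∉ O ∧ lam w = {a}) → (u ∈ A ↔ u = v) := by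
    intro A u v a hu ha h
    simpa [hu, ha] using Finset.ext_iff.1 h u
  refine ⟨⟨fun _ h => h⟩, ⟨fun _ _ _ h _ => h⟩, hp, fun u hu => ⟨fun hX => ?_, fun hY => ?_,
    fun hZ => ?_⟩⟩
  · have key v (hv : v ∉ O) := mem_iff_eq hu (lam_ne hX (by decide)) (hnf v hv).1
    exact ⟨(key u hu).2 rfl, fun v hv hvu _ h => hvu ((key v hv).1 h).symm⟩
  · rcases hreal u hu with h | h | h <;> simp [h] at hY
  · have key v (hv : v ∉ O) := mem_iff_eq hu (lam_ne hZ (by decide)) (hnf v hv).2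
    exact ⟨(key u hu).2 rfl, fun v hv hvu _ h => hvu ((key v hv).1 h).symm⟩
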